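/- Let F ⊆ Sym²(ℝⁿ) be a convex cone subequation with edge E = F ∩ (−F), polar cone F₊, dual span S = span(F₊), orthogonal projection π : Sym²(ℝⁿ) → S, and reduced constraint set F₀ = π(F). If F is polar self dual, i.e., F₀ = F₊, then F₀ = π(𝒫) and F = E + 𝒫; that is, F is the minimal subequation with edge E. -/

import Mathlib

open Matrix Set Pointwise

noncomputable section

/-- `Sym²(ℝⁿ)`: the space of real symmetric `n × n` matrices,
realized as the self-adjoint elements of the matrix algebra. -/
abbrev SymMat (n : ℕ) : Type := ↥(selfAdjoint (Matrix (Fin n) (Fin n) ℝ))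

namespace SymMat

variable {n : ℕ}

/-- The trace inner product `⟨A, B⟩ = tr (A * B)` on `Sym²(ℝⁿ)`. -/
def tinner (A B : SymMat n) : ℝ :=
  ((A : Matrix (Fin n) (Fin n) ℝ) * (B : Matrix (Fin n) (Fin n) ℝ)).trace

/-- `𝒫`: the closed convex cone of positive semidefinite matrices. -/
def Psd (n : ℕ) : Set (SymMat n) :=
  {A | (A : Matrix (Fin n) (Fin n) ℝ).PosSemidef}

/-- The set of positive definite matrices (= `Int 𝒫`). -/
def Pd (n : ℕ) : Set (SymMat n) :=
  {A | (A : Matrix (Fin n) (Fin n) ℝ).PosDef}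

/-- A convex cone subequation: a closed convex cone `F ⊆ Sym²(ℝⁿ)` which is a nonempty
proper subset and satisfies the positivity condition `F + 𝒫 = F`. -/
structure IsSubequation (F : Set (SymMat n)) : Prop where
  nonempty : F.Nonempty
  proper : F ≠ Set.univ
  isClosed : IsClosed F
  convex : Convex ℝ F
  cone : ∀ t : ℝ, 0 ≤ t → ∀ A ∈ F, t • A ∈ F
  positivity : ∀ A ∈ F, ∀ P ∈ Psd n, A + P ∈ F

/-- The polar cone `F₊ = {B : ⟨A,B⟩ ≥ 0 ∀ A ∈ F}`. -/
def polarCone (F : Set (SymMat n)) : Set (SymMat n) :=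
  {B | ∀ A ∈ F, 0 ≤ tinner A B}

/-- The edge `E = F ∩ (−F)`. -/
def edge (F : Set (SymMat n)) : Set (SymMat n) := F ∩ (-F)

/-- Orthogonal complement (as a set) with respect to the trace inner product. -/
def orthSet (E : Set (SymMat n)) : Set (SymMat n) :=
  {B | ∀ A ∈ E, tinner A B = 0}

/-- `P_e = e eᵀ`, orthogonal projection onto the line spanned by `e`, as a symmetric matrix. -/
def lineProj (e : EuclideanSpace ℝ (Fin n)) : SymMat n :=
  ⟨Matrix.vecMulVec (WithLp.equiv 2 (Fin n → ℝ) e) (WithLp.equiv 2 (Fin n → ℝ) e), by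
    refine selfAdjoint.mem_iff.mpr ?_
    ext i j
    simp [Matrix.conjTranspose_apply, Matrix.vecMulVec_apply, mul_comm]⟩

/-- The matrix `P_W` of the orthogonal projection onto a subspace `W ⊆ ℝⁿ`. -/
def projMat (W : Submodule ℝ (EuclideanSpace ℝ (Fin n))) : Matrix (Fin n) (Fin n) ℝ :=
  Matrix.toEuclideanLin.symm ((W.subtypeL.comp (Submodule.orthogonalProjectionOnto W)).toLinearMap)

/-- `Sym²(W) = {A : A = P_W A P_W}`. -/
def symOn (W : Submodule ℝ (EuclideanSpace ℝ (Fin n))) : Set (SymMat n) :=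
  {A | (A : Matrix (Fin n) (Fin n) ℝ) = projMat W * A * projMat W}

/-- The restriction `F_W = {P_W A P_W : A ∈ F}` of `F` to `W` (inside `Sym²(W)`). -/
def restrictTo (F : Set (SymMat n)) (W : Submodule ℝ (EuclideanSpace ℝ (Fin n))) :
    Set (SymMat n) :=
  {B | ∃ A ∈ F, (B : Matrix (Fin n) (Fin n) ℝ) = projMat W * A * projMat W}

/-- `F` is extremely degenerate: the polar cone only involves the variables of some
proper subspace `W ⊊ ℝⁿ`. -/
def IsExtremelyDegenerate (F : Set (SymMat n)) : Prop :=
  ∃ W : Submodule ℝ (EuclideanSpace ℝ (Fin n)), W ≠ ⊤ ∧ polarCone F ⊆ symOn W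

/-- `F` is (dimensionally) complete. -/
def IsComplete (F : Set (SymMat n)) : Prop := ¬ IsExtremelyDegenerate F

/-- The interior of `F` relative to `S`. -/
def relInt (S F : Set (SymMat n)) : Set (SymMat n) :=
  {B | B ∈ S ∧ ∃ U : Set (SymMat n), IsOpen U ∧ B ∈ U ∧ U ∩ S ⊆ F}

/-- The support of `F`: the intersection of all subspaces `W'` with `F₊ ⊆ Sym²(W')`. -/
def support (F : Set (SymMat n)) : Submodule ℝ (EuclideanSpace ℝ (Fin n)) :=
  sInf {W | polarCone F ⊆ symOn W}

/-- The polar cone of `G` taken within `Sym²(W)`. -/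
def polarIn (G : Set (SymMat n)) (W : Submodule ℝ (EuclideanSpace ℝ (Fin n))) :
    Set (SymMat n) :=
  {B | B ∈ symOn W ∧ ∀ A ∈ G, 0 ≤ tinner A B}

end SymMat

namespace SymMat

variable {n : ℕ}

theorem tinner_comm (A B : SymMat n) : tinner A B = tinner B A := Matrix.trace_mul_comm _ _

theorem tinner_self_pos {A : SymMat n} (h : tinner A A = 0) : A = 0 := by
  have hA : (A : Matrix (Fin n) (Fin n) ℝ)ᴴ = A := selfAdjoint.mem_iff.mp A.2
  have h1 : ((A : Matrix (Fin n) (Fin n) ℝ)ᴴ * (A : Matrix (Fin n) (Fin n) ℝ)).trace = 0 := by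
    rw [hA]; exact h
  exact Subtype.ext (Matrix.trace_conjTranspose_mul_self_eq_zero_iff.mp h1)

/-- The trace inner product as a bilinear form. -/
def tB (n : ℕ) : LinearMap.BilinForm ℝ (SymMat n) :=
  LinearMap.mk₂ ℝ tinner
    (by intros; simp [tinner, add_mul]) (by intros; simp [tinner])
    (by intros; simp [tinner, mul_add]) (by intros; simp [tinner])

theorem tB_apply (A B : SymMat n) : tB n A B = tinner A B := rfl

theorem tB_refl : (tB n).IsRefl := by
  intro x y h
  exact (tinner_comm y x).trans h

theorem tB_nondeg : (tB n).Nondegenerate :=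
  ⟨fun x h => tinner_self_pos (h x), fun x h => tinner_self_pos (h x)⟩

/-- Inclusion into functions. -/
def incl (n : ℕ) : SymMat n →ₗ[ℝ] (Fin n → Fin n → ℝ) where
  toFun A := (A : Matrix (Fin n) (Fin n) ℝ)
  map_add' _ _ := rfl
  map_smul' _ _ := rfl

theorem incl_inj : Function.Injective (incl n) := fun _ _ h => Subtype.ext h

theorem finDim : FiniteDimensional ℝ (SymMat n) :=
  FiniteDimensional.of_injective (incl n) incl_inj

theorem locConv : LocallyConvexSpace ℝ (SymMat n) :=
  LocallyConvexSpace.induced (incl n)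

theorem contSMul : ContinuousSMul ℝ (SymMat n) :=
  ⟨Continuous.subtype_mk (continuous_fst.smul (continuous_subtype_val.comp continuous_snd)) _⟩

theorem decomp (S : Submodule ℝ (SymMat n)) (A : SymMat n) :
    ∃ s ∈ S, ∃ e ∈ orthSet (S : Set (SymMat n)), s + e = A := by
  have := finDim (n := n)
  have h : IsCompl S ((tB n).orthogonal S) := by
    rw [LinearMap.BilinForm.isCompl_orthogonal_iff_disjoint tB_refl, Submodule.disjoint_def]
    intro x hx hx'
    exact tinner_self_pos (hx' x hx)
  have hA : A ∈ S ⊔ (tB n).orthogonal S := by rw [h.sup_eq_top]; trivial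
  obtain ⟨s, hs, e, he, rfl⟩ := Submodule.mem_sup.mp hA
  exact ⟨s, hs, e, fun B hB => he B hB, rfl⟩

theorem zero_mem {F : Set (SymMat n)} (hF : IsSubequation F) : (0 : SymMat n) ∈ F := by
  obtain ⟨A, hA⟩ := hF.nonempty
  simpa using hF.cone 0 le_rfl A hA

theorem psd_subset {F : Set (SymMat n)} (hF : IsSubequation F) : Psd n ⊆ F := fun P hP => by
  simpa using hF.positivity 0 (zero_mem hF) P hP

theorem polar_subset {F : Set (SymMat n)} (hF : IsSubequation F) : polarCone F ⊆ Psd n := by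
  intro B hB
  refine Matrix.PosSemidef.of_dotProduct_mulVec_nonneg (selfAdjoint.mem_iff.mp B.2) fun x => ?_
  have hp := Matrix.posSemidef_vecMulVec_self_star x
  have := hB ⟨_, hp.1⟩ (psd_subset hF hp)
  simp only [tinner] at this
  rwa [Matrix.trace_mul_comm, Matrix.mul_vecMulVec, Matrix.trace_vecMulVec, dotProduct_comm] at this

theorem bipolar {F : Set (SymMat n)} (hF : IsSubequation F) {A : SymMat n}
    (hA : ∀ B ∈ polarCone F, 0 ≤ tinner A B) : A ∈ F := by
  have := finDim (n := n)
  have := locConv (n := n)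
  have := contSMul (n := n)
  by_contra hn
  obtain ⟨f, u, h1, h2⟩ := geometric_hahn_banach_point_closed hF.convex hF.isClosed hn
  set B := ((tB n).toDual tB_nondeg).symm f.toLinearMap with hBdef
  have hB : ∀ v, tinner v B = f v := fun v => by
    rw [tinner_comm, ← tB_apply, hBdef]
    simp
  have hu : u < 0 := by simpa using h2 0 (zero_mem hF)
  have hBp : B ∈ polarCone F := by
    intro v hv
    rw [hB]
    by_contra hneg
    push Not at hneg
    have h3 := h2 _ (hF.cone (u / f v) (div_nonneg_of_nonpos hu.le hneg.le) v hv)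
    rw [map_smul, smul_eq_mul, div_mul_cancel₀ _ hneg.ne] at h3
    exact lt_irrefl _ h3
  have := hA B hBp
  rw [hB] at this
  linarith

end SymMat

open SymMat in
theorem polar_self_dual_is_minimal {n : ℕ} (F : Set (SymMat n)) (hF : IsSubequation F)
    (S : Submodule ℝ (SymMat n)) (hSdef : S = Submodule.span ℝ (polarCone F))
    (F0 : Set (SymMat n))
    (hF0 : F0 = (F + orthSet (S : Set (SymMat n))) ∩ (S : Set (SymMat n)))
    (hsd : F0 = polarCone F) :
    F0 = (Psd n + orthSet (S : Set (SymMat n))) ∩ (S : Set (SymMat n)) ∧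
    F = edge F + Psd n := by
  have horth : ∀ e ∈ orthSet (S : Set (SymMat n)), -e ∈ orthSet (S : Set (SymMat n)) := by
    intro e he A hA
    have := he A hA
    rw [← tB_apply] at *
    simp [this]
  have hF' : ∀ e ∈ orthSet (S : Set (SymMat n)), e ∈ F := fun e he =>
    bipolar hF fun B hB => by
      rw [tinner_comm, he B (by rw [hSdef]; exact Submodule.subset_span hB)]
  have hE : ∀ e ∈ orthSet (S : Set (SymMat n)), e ∈ edge F := fun e he =>
    ⟨hF' e he, hF' _ (horth e he)⟩
  constructor
  · apply Set.Subset.antisymm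
    · intro B hB
      have hP : B ∈ Psd n := polar_subset hF (hsd ▸ hB)
      rw [hF0] at hB
      refine ⟨⟨B, hP, 0, fun A _ => ?_, add_zero B⟩, hB.2⟩
      simp [tinner]
    · rw [hF0]
      exact Set.inter_subset_inter_left _ (Set.add_subset_add_right (psd_subset hF))
  · apply Set.Subset.antisymm
    · intro A hA
      obtain ⟨s, hs, e, he, rfl⟩ := decomp S A
      have hs0 : s ∈ F0 := by
        rw [hF0]
        exact ⟨⟨s + e, hA, -e, horth e he, by simp⟩, hs⟩
      rw [hsd] at hs0
      exact ⟨e, hE e he, s, polar_subset hF hs0, add_comm _ _⟩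
    · rintro _ ⟨e, he, P, hP, rfl⟩
      exact hF.positivity e he.1 P hP
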